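/- Suppose C, K, B, and all N_j are analytic at σ_1,…,σ_k ∈ ℂ and that K(σ_i) and K̂(σ_i) = Wᴴ K(σ_i) V are invertible for all i = 1,…,k. Let b ∈ ℂ^m, c ∈ ℂ^p, and nonnegative integers ℓ_1,…,ℓ_k be given. Let the column space of V contain the columns of the blockwise Hermite matrices built from σ_1,…,σ_k, b, and derivative orders ℓ_1,…,ℓ_k (the derivative analogue of V_1 = K(σ_1)^{-1}B(σ_1)b, V_j = K(σ_j)^{-1}N(σ_{j-1})(I_m ⊗ V_{j-1})), and let the column space of W contain the columns of W_{1,i} = (∂_{s^i}(cᴴ C K^{-1})(σ_k))ᴴ (i = 0,…,ℓ_k) and W_{i,j} = (∂_{s^j}((I_m ⊗ W_{i-1,ℓ_{k-i+2}})ᴴ Ñ K^{-1})(σ_{k-i+1}))ᴴ (2 ≤ i ≤ k, j = 0,…,ℓ_{k-i+1}), i.e., identical interpolation points and derivative orders on both sides. Then, in addition, all first-order partial derivatives with respect to s_1,…,s_k of the function (s_1,…,s_k) ↦ cᴴ ∂_{s_1^{ℓ_1} ⋯ s_k^{ℓ_k}} G_k(s_1,…,s_k)(I_{m^{k-1}}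 ⊗ b) coincide with those of the corresponding reduced-order function with G_k replaced by Ĝ_k, evaluated at (σ_1,…,σ_k). -/

import Mathlib

open Matrix
open scoped Kronecker

namespace StructBilin

/-- Scaled sum of the bilinear terms: `𝔑(s, d) = ∑ i, d i • N i s`. -/
noncomputable def Nsum {n m : ℕ} (N : Fin m → ℂ → Matrix (Fin n) (Fin n) ℂ) (s : ℂ)
    (d : Fin m → ℂ) : Matrix (Fin n) (Fin n) ℂ :=
  ∑ i, d i • N i s

/-- Middle factor of the modified transfer function
`𝔾_{q+1}(σ 0, …, σ q | d 0, …, d (q-1)) = C (σ q) * gAux K B N σ d q`. -/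
noncomputable def gAux {n m : ℕ} (K : ℂ → Matrix (Fin n) (Fin n) ℂ)
    (B : ℂ → Matrix (Fin n) (Fin m) ℂ) (N : Fin m → ℂ → Matrix (Fin n) (Fin n) ℂ)
    (σ : ℕ → ℂ) (d : ℕ → Fin m → ℂ) : ℕ → Matrix (Fin n) (Fin m) ℂ
  | 0 => (K (σ 0))⁻¹ * B (σ 0)
  | j + 1 => (K (σ (j + 1)))⁻¹ * Nsum N (σ j) (d j) * gAux K B N σ d j

/-- The modified (scaled and summed) transfer function
`𝔾_{q+1}(σ 0, …, σ q | d 0, …, d (q-1))` (the level is `q + 1`, indices are 0-based). -/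
noncomputable def Gmod {n m p : ℕ} (C : ℂ → Matrix (Fin p) (Fin n) ℂ)
    (K : ℂ → Matrix (Fin n) (Fin n) ℂ) (B : ℂ → Matrix (Fin n) (Fin m) ℂ)
    (N : Fin m → ℂ → Matrix (Fin n) (Fin n) ℂ) (σ : ℕ → ℂ) (d : ℕ → Fin m → ℂ)
    (q : ℕ) : Matrix (Fin p) (Fin m) ℂ :=
  C (σ q) * gAux K B N σ d q

/-- Right tangential interpolation vectors:
`v 0 = K(σ 0)⁻¹ B(σ 0) b`, `v (j+1) = K(σ (j+1))⁻¹ 𝔑(σ j, d j) v j`. -/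
noncomputable def vtan {n m : ℕ} (K : ℂ → Matrix (Fin n) (Fin n) ℂ)
    (B : ℂ → Matrix (Fin n) (Fin m) ℂ) (N : Fin m → ℂ → Matrix (Fin n) (Fin n) ℂ)
    (σ : ℕ → ℂ) (d : ℕ → Fin m → ℂ) (b : Fin m → ℂ) : ℕ → Fin n → ℂ
  | 0 => (K (σ 0))⁻¹ *ᵥ (B (σ 0) *ᵥ b)
  | j + 1 => (K (σ (j + 1)))⁻¹ *ᵥ (Nsum N (σ j) (d j) *ᵥ vtan K B N σ d b j)

/-- Left tangential interpolation vectors (with reversed point sequence `τ` and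
scaling sequence `e`):
`w 0 = K(τ 0)^{-ᴴ} C(τ 0)ᴴ c`, `w (t+1) = K(τ (t+1))^{-ᴴ} 𝔑(τ (t+1), e t)ᴴ w t`. -/
noncomputable def wtan {n m p : ℕ} (C : ℂ → Matrix (Fin p) (Fin n) ℂ)
    (K : ℂ → Matrix (Fin n) (Fin n) ℂ) (N : Fin m → ℂ → Matrix (Fin n) (Fin n) ℂ)
    (τ : ℕ → ℂ) (e : ℕ → Fin m → ℂ) (c : Fin p → ℂ) : ℕ → Fin n → ℂ
  | 0 => ((K (τ 0))⁻¹)ᴴ *ᵥ ((C (τ 0))ᴴ *ᵥ c)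
  | t + 1 => ((K (τ (t + 1)))⁻¹)ᴴ *ᵥ ((Nsum N (τ (t + 1)) (e t))ᴴ *ᵥ wtan C K N τ e c t)

/-- Entrywise `t`-th complex derivative of a matrix-valued function. -/
noncomputable def mDeriv {α β : Type*} (t : ℕ) (f : ℂ → Matrix α β ℂ) (z : ℂ) :
    Matrix α β ℂ :=
  Matrix.of fun i j => iteratedDeriv t (fun w => f w i j) z

/-- Entrywise `t`-th complex derivative of a vector-valued function. -/
noncomputable def vDeriv {α : Type*} (t : ℕ) (f : ℂ → α → ℂ) (z : ℂ) : α → ℂ :=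
  fun i => iteratedDeriv t (fun w => f w i) z

/-- Partial derivative in the `i`-th coordinate of a function of countably many
complex variables. -/
noncomputable def pD (i : ℕ) (f : (ℕ → ℂ) → ℂ) (s : ℕ → ℂ) : ℂ :=
  deriv (fun z => f (Function.update s i z)) (s i)

/-- Mixed partial derivative `∂_{s_1^{ord 0} ⋯ s_t^{ord (t-1)}}` of a function of the
first `t` coordinates. -/
noncomputable def mixedD (ord : ℕ → ℕ) : ℕ → ((ℕ → ℂ) → ℂ) → (ℕ → ℂ) → ℂ
  | 0, f => f
  | t + 1, f => mixedD ord t ((pD t)^[ord t] f)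

/-- The Hermite chain
`hChain t = ∂^{ℓ (t)}(𝔑(·, d t) K⁻¹)(σ t) ⋯ ∂^{ℓ 0}(𝔑(·, d 0) K⁻¹ B)(σ 0)`. -/
noncomputable def hChain {n m : ℕ} (K : ℂ → Matrix (Fin n) (Fin n) ℂ)
    (B : ℂ → Matrix (Fin n) (Fin m) ℂ) (N : Fin m → ℂ → Matrix (Fin n) (Fin n) ℂ)
    (σ : ℕ → ℂ) (d : ℕ → Fin m → ℂ) (ℓ : ℕ → ℕ) : ℕ → Matrix (Fin n) (Fin m) ℂ
  | 0 => mDeriv (ℓ 0) (fun z => Nsum N z (d 0) * ((K z)⁻¹ * B z)) (σ 0)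
  | t + 1 =>
      mDeriv (ℓ (t + 1)) (fun z => Nsum N z (d (t + 1)) * (K z)⁻¹) (σ (t + 1)) *
        hChain K B N σ d ℓ t

/-- Right tangential Hermite interpolation vectors. -/
noncomputable def vHerm {n m : ℕ} (K : ℂ → Matrix (Fin n) (Fin n) ℂ)
    (B : ℂ → Matrix (Fin n) (Fin m) ℂ) (N : Fin m → ℂ → Matrix (Fin n) (Fin n) ℂ)
    (σ : ℕ → ℂ) (d : ℕ → Fin m → ℂ) (ℓ : ℕ → ℕ) (b : Fin m → ℂ) : ℕ → ℕ → Fin n → ℂ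
  | 0, j => mDeriv j (fun z => (K z)⁻¹ * B z) (σ 0) *ᵥ b
  | t + 1, j => (mDeriv j (fun z => (K z)⁻¹) (σ (t + 1)) * hChain K B N σ d ℓ t) *ᵥ b

/-- Left tangential Hermite interpolation vectors (with reversed sequences). -/
noncomputable def wHerm {n m p : ℕ} (C : ℂ → Matrix (Fin p) (Fin n) ℂ)
    (K : ℂ → Matrix (Fin n) (Fin n) ℂ) (N : Fin m → ℂ → Matrix (Fin n) (Fin n) ℂ)
    (τ : ℕ → ℂ) (e : ℕ → Fin m → ℂ) (eν : ℕ → ℕ) (c : Fin p → ℂ) : ℕ → ℕ → Fin n → ℂ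
  | 0, i => star (vDeriv i (fun z => Matrix.vecMul (star c) (C z * (K z)⁻¹)) (τ 0))
  | t + 1, j =>
      star (vDeriv j (fun z =>
        Matrix.vecMul (star (wHerm C K N τ e eν c t (eν t))) (Nsum N z (e t) * (K z)⁻¹))
        (τ (t + 1)))

/-- Column index type of the `j+1`-st subsystem transfer function (`m^(j+1)` indices). -/
def colT (m : ℕ) : ℕ → Type
  | 0 => Fin m
  | j + 1 => Fin m × colT m j

def colTFintype (m : ℕ) : ∀ j, Fintype (colT m j)
  | 0 => inferInstanceAs (Fintype (Fin m))
  | j + 1 => letI := colTFintype m j; inferInstanceAs (Fintype (Fin m × colT m j))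

attribute [instance] colTFintype

/-- Block index type (`m^j` indices). -/
def outT (m : ℕ) : ℕ → Type
  | 0 => Fin 1
  | j + 1 => Fin m × outT m j

def outTFintype (m : ℕ) : ∀ j, Fintype (outT m j)
  | 0 => inferInstanceAs (Fintype (Fin 1))
  | j + 1 => letI := outTFintype m j; inferInstanceAs (Fintype (Fin m × outT m j))

attribute [instance] outTFintype

/-- The horizontal concatenation `N(s) = [N_1(s) ⋯ N_m(s)]`. -/
noncomputable def Nbig {n m : ℕ} (N : Fin m → ℂ → Matrix (Fin n) (Fin n) ℂ) (s : ℂ) :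
    Matrix (Fin n) (Fin m × Fin n) ℂ :=
  Matrix.of fun i q => N q.1 s i q.2

/-- The vertical concatenation `Ñ(s)` of `N_1(s), …, N_m(s)`. -/
noncomputable def Ntil {n m : ℕ} (N : Fin m → ℂ → Matrix (Fin n) (Fin n) ℂ) (s : ℂ) :
    Matrix (Fin m × Fin n) (Fin n) ℂ :=
  Matrix.of fun q i => N q.1 s q.2 i

/-- State part of the `j+1`-st subsystem transfer function:
`Z 0 = K(σ 0)⁻¹ B(σ 0)`, `Z (j+1) = K(σ (j+1))⁻¹ N(σ j) (I_m ⊗ Z j)`. -/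
noncomputable def Zblk {n m : ℕ} (K : ℂ → Matrix (Fin n) (Fin n) ℂ)
    (B : ℂ → Matrix (Fin n) (Fin m) ℂ) (N : Fin m → ℂ → Matrix (Fin n) (Fin n) ℂ)
    (σ : ℕ → ℂ) : (j : ℕ) → Matrix (Fin n) (colT m j) ℂ
  | 0 => (K (σ 0))⁻¹ * B (σ 0)
  | j + 1 =>
      (K (σ (j + 1)))⁻¹ * Nbig N (σ j) *
        ((1 : Matrix (Fin m) (Fin m) ℂ) ⊗ₖ Zblk K B N σ j)

/-- The `q+1`-st subsystem transfer function `G_{q+1}(σ 0, …, σ q)`. -/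
noncomputable def Gblk {n m p : ℕ} (C : ℂ → Matrix (Fin p) (Fin n) ℂ)
    (K : ℂ → Matrix (Fin n) (Fin n) ℂ) (B : ℂ → Matrix (Fin n) (Fin m) ℂ)
    (N : Fin m → ℂ → Matrix (Fin n) (Fin n) ℂ) (σ : ℕ → ℂ) (q : ℕ) :
    Matrix (Fin p) (colT m q) ℂ :=
  C (σ q) * Zblk K B N σ q

/-- The tangential direction matrix `I_{m^j} ⊗ b`. -/
noncomputable def tangMat {m : ℕ} (b : Fin m → ℂ) :
    (j : ℕ) → Matrix (colT m j) (outT m j) ℂ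
  | 0 => Matrix.of fun i _ => b i
  | j + 1 => (1 : Matrix (Fin m) (Fin m) ℂ) ⊗ₖ tangMat b j

/-- Blockwise right interpolation matrices:
`V 0 = K(σ 0)⁻¹ B(σ 0) b`, `V (j+1) = K(σ (j+1))⁻¹ N(σ j) (I_m ⊗ V j)`. -/
noncomputable def Vblk {n m : ℕ} (K : ℂ → Matrix (Fin n) (Fin n) ℂ)
    (B : ℂ → Matrix (Fin n) (Fin m) ℂ) (N : Fin m → ℂ → Matrix (Fin n) (Fin n) ℂ)
    (σ : ℕ → ℂ) (b : Fin m → ℂ) : (j : ℕ) → Matrix (Fin n) (outT m j) ℂ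
  | 0 => Matrix.of fun i _ => ((K (σ 0))⁻¹ *ᵥ (B (σ 0) *ᵥ b)) i
  | j + 1 =>
      (K (σ (j + 1)))⁻¹ * Nbig N (σ j) *
        ((1 : Matrix (Fin m) (Fin m) ℂ) ⊗ₖ Vblk K B N σ b j)

/-- Blockwise left interpolation matrices (with reversed point sequence `τ`):
`W 0 = K(τ 0)^{-ᴴ} C(τ 0)ᴴ c`, `W (t+1) = K(τ (t+1))^{-ᴴ} Ñ(τ (t+1))ᴴ (I_m ⊗ W t)`. -/
noncomputable def Wblk {n m p : ℕ} (C : ℂ → Matrix (Fin p) (Fin n) ℂ)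
    (K : ℂ → Matrix (Fin n) (Fin n) ℂ) (N : Fin m → ℂ → Matrix (Fin n) (Fin n) ℂ)
    (τ : ℕ → ℂ) (c : Fin p → ℂ) : (t : ℕ) → Matrix (Fin n) (outT m t) ℂ
  | 0 => Matrix.of fun i _ => (((K (τ 0))⁻¹)ᴴ *ᵥ ((C (τ 0))ᴴ *ᵥ c)) i
  | t + 1 =>
      ((K (τ (t + 1)))⁻¹)ᴴ * (Ntil N (τ (t + 1)))ᴴ *
        ((1 : Matrix (Fin m) (Fin m) ℂ) ⊗ₖ Wblk C K N τ c t)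

/-- A vector as a one-column matrix. -/
noncomputable def bCol {m : ℕ} (b : Fin m → ℂ) : Matrix (Fin m) (Fin 1) ℂ :=
  Matrix.of fun i _ => b i

/-- Blockwise Hermite chain. -/
noncomputable def hChainB {n m : ℕ} (K : ℂ → Matrix (Fin n) (Fin n) ℂ)
    (B : ℂ → Matrix (Fin n) (Fin m) ℂ) (N : Fin m → ℂ → Matrix (Fin n) (Fin n) ℂ)
    (σ : ℕ → ℂ) (ℓ : ℕ → ℕ) (b : Fin m → ℂ) :
    (t : ℕ) → Matrix (Fin n) (outT m (t + 1)) ℂ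
  | 0 => mDeriv (ℓ 0)
      (fun z => Nbig N z * ((1 : Matrix (Fin m) (Fin m) ℂ) ⊗ₖ ((K z)⁻¹ * B z * bCol b)))
      (σ 0)
  | t + 1 =>
      mDeriv (ℓ (t + 1))
        (fun z => Nbig N z * ((1 : Matrix (Fin m) (Fin m) ℂ) ⊗ₖ (K z)⁻¹)) (σ (t + 1)) *
        ((1 : Matrix (Fin m) (Fin m) ℂ) ⊗ₖ hChainB K B N σ ℓ b t)

/-- Blockwise right Hermite interpolation matrices. -/
noncomputable def vHermB {n m : ℕ} (K : ℂ → Matrix (Fin n) (Fin n) ℂ)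
    (B : ℂ → Matrix (Fin n) (Fin m) ℂ) (N : Fin m → ℂ → Matrix (Fin n) (Fin n) ℂ)
    (σ : ℕ → ℂ) (ℓ : ℕ → ℕ) (b : Fin m → ℂ) : (t : ℕ) → ℕ → Matrix (Fin n) (outT m t) ℂ
  | 0, j => mDeriv j (fun z => (K z)⁻¹ * B z * bCol b) (σ 0)
  | t + 1, j => mDeriv j (fun z => (K z)⁻¹) (σ (t + 1)) * hChainB K B N σ ℓ b t

/-- Blockwise left Hermite interpolation matrices (with reversed sequences). -/
noncomputable def wHermB {n m p : ℕ} (C : ℂ → Matrix (Fin p) (Fin n) ℂ)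
    (K : ℂ → Matrix (Fin n) (Fin n) ℂ) (N : Fin m → ℂ → Matrix (Fin n) (Fin n) ℂ)
    (τ : ℕ → ℂ) (eν : ℕ → ℕ) (c : Fin p → ℂ) : (t : ℕ) → ℕ → Matrix (Fin n) (outT m t) ℂ
  | 0, i => Matrix.of fun idx _ =>
      star (iteratedDeriv i (fun z => Matrix.vecMul (star c) (C z * (K z)⁻¹) idx) (τ 0))
  | t + 1, j => Matrix.of fun idx cc =>
      star (iteratedDeriv j (fun z =>
        (((1 : Matrix (Fin m) (Fin m) ℂ) ⊗ₖ wHermB C K N τ eν c t (eν t))ᴴ * Ntil N z *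
          (K z)⁻¹) cc idx) (τ (t + 1)))

/-- The Kronecker product `d (j-1) ⊗ ⋯ ⊗ d 0 ⊗ I_m` of scaling vectors with the identity. -/
noncomputable def dKron {m : ℕ} (d : ℕ → Fin m → ℂ) :
    (j : ℕ) → Matrix (colT m j) (Fin m) ℂ
  | 0 => (1 : Matrix (Fin m) (Fin m) ℂ)
  | j + 1 => Matrix.of fun (pq : Fin m × colT m j) cix => d j pq.1 * dKron d j pq.2 cix

/-- The innermost (input) coordinate of a column multi-index. -/
def innerIdx (m : ℕ) : (j : ℕ) → colT m j → Fin m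
  | 0 => fun x => x
  | j + 1 => fun (pq : Fin m × colT m j) => innerIdx m j pq.2

/-- The chain `K(σ t)⁻¹ N_{J (t-1)}(σ (t-1)) ⋯ N_{J 0}(σ 0) K(σ 0)⁻¹ B(σ 0)`. -/
noncomputable def eChain {n m : ℕ} (K : ℂ → Matrix (Fin n) (Fin n) ℂ)
    (B : ℂ → Matrix (Fin n) (Fin m) ℂ) (N : Fin m → ℂ → Matrix (Fin n) (Fin n) ℂ)
    (σ : ℕ → ℂ) (J : ℕ → Fin m) : ℕ → Matrix (Fin n) (Fin m) ℂ
  | 0 => (K (σ 0))⁻¹ * B (σ 0)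
  | t + 1 => (K (σ (t + 1)))⁻¹ * N (J t) (σ t) * eChain K B N σ J t

/-- Entrywise analyticity of a vector-valued function at a point. -/
def VecAnalyticAt {α : Type*} (f : ℂ → α → ℂ) (z : ℂ) : Prop :=
  ∀ i, AnalyticAt ℂ (fun w => f w i) z

/-- Entrywise analyticity of a matrix-valued function at a point. -/
def MatAnalyticAt {α β : Type*} (f : ℂ → Matrix α β ℂ) (z : ℂ) : Prop :=
  ∀ i j, AnalyticAt ℂ (fun w => f w i j) z

section Analytic

variable {α β γ δ : Type*} {z₀ : ℂ}

theorem vecAnalyticAt_const (v : α → ℂ) : VecAnalyticAt (fun _ => v) z₀ :=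
  fun _ => analyticAt_const

theorem matAnalyticAt_const (A : Matrix α β ℂ) : MatAnalyticAt (fun _ => A) z₀ :=
  fun _ _ => analyticAt_const

theorem MatAnalyticAt.row {A : ℂ → Matrix γ α ℂ} (hA : MatAnalyticAt A z₀) (i : γ) :
    VecAnalyticAt (fun z => A z i) z₀ := hA i

theorem MatAnalyticAt.transpose {A : ℂ → Matrix γ α ℂ} (hA : MatAnalyticAt A z₀) :
    MatAnalyticAt (fun z => (A z)ᵀ) z₀ := fun i j => hA j i

theorem VecAnalyticAt.sub {f g : ℂ → α → ℂ} (hf : VecAnalyticAt f z₀)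
    (hg : VecAnalyticAt g z₀) : VecAnalyticAt (fun z => f z - g z) z₀ :=
  fun i => (hf i).sub (hg i)

theorem vDeriv_congr {f g : ℂ → γ → ℂ} (h : ∀ᶠ z in nhds z₀, f z = g z) (t : ℕ) :
    vDeriv t f z₀ = vDeriv t g z₀ :=
  funext fun i => Filter.EventuallyEq.iteratedDeriv_eq t (h.mono fun _ hz => congrFun hz i)

theorem vDeriv_sub {f g : ℂ → γ → ℂ} (hf : VecAnalyticAt f z₀) (hg : VecAnalyticAt g z₀)
    (t : ℕ) : vDeriv t (fun z => f z - g z) z₀ = vDeriv t f z₀ - vDeriv t g z₀ :=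
  funext fun i => iteratedDeriv_fun_sub (hf i).contDiffAt (hg i).contDiffAt

variable [Fintype α]

theorem VecAnalyticAt.dotProduct {f g : ℂ → α → ℂ} (hf : VecAnalyticAt f z₀)
    (hg : VecAnalyticAt g z₀) : AnalyticAt ℂ (fun z => f z ⬝ᵥ g z) z₀ :=
  Finset.analyticAt_fun_sum _ fun i _ => (hf i).mul (hg i)

theorem MatAnalyticAt.mulVec {A : ℂ → Matrix γ α ℂ} {f : ℂ → α → ℂ}
    (hA : MatAnalyticAt A z₀) (hf : VecAnalyticAt f z₀) :
    VecAnalyticAt (fun z => A z *ᵥ f z) z₀ :=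
  fun i => (hA.row i).dotProduct hf

theorem VecAnalyticAt.vecMul {A : ℂ → Matrix α γ ℂ} {f : ℂ → α → ℂ}
    (hf : VecAnalyticAt f z₀) (hA : MatAnalyticAt A z₀) :
    VecAnalyticAt (fun z => f z ᵥ* A z) z₀ :=
  fun i => hf.dotProduct (hA.transpose.row i)

theorem MatAnalyticAt.mul {A : ℂ → Matrix γ α ℂ} {D : ℂ → Matrix α δ ℂ}
    (hA : MatAnalyticAt A z₀) (hD : MatAnalyticAt D z₀) :
    MatAnalyticAt (fun z => A z * D z) z₀ :=
  fun i j => (hA.row i).dotProduct (hD.transpose.row j)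

theorem MatAnalyticAt.det [DecidableEq α] {A : ℂ → Matrix α α ℂ} (hA : MatAnalyticAt A z₀) :
    AnalyticAt ℂ (fun z => (A z).det) z₀ := by
  simp only [Matrix.det_apply']
  exact Finset.analyticAt_fun_sum _ fun σ _ =>
    analyticAt_const.mul (Finset.analyticAt_fun_prod _ fun i _ => hA _ _)

theorem MatAnalyticAt.inv [DecidableEq α] {A : ℂ → Matrix α α ℂ} (hA : MatAnalyticAt A z₀)
    (h : IsUnit (A z₀).det) : MatAnalyticAt (fun z => (A z)⁻¹) z₀ := by
  intro i j
  simp only [Matrix.inv_def, Matrix.smul_apply, smul_eq_mul, Ring.inverse_eq_inv',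
    Matrix.adjugate_apply]
  refine (hA.det.inv h.ne_zero).mul (MatAnalyticAt.det fun a e => ?_)
  by_cases ha : a = j
  · simpa [Matrix.updateRow_apply, ha] using analyticAt_const
  · simpa [Matrix.updateRow_apply, ha] using hA a e

theorem MatAnalyticAt.eventually_isUnit_det [DecidableEq α] {A : ℂ → Matrix α α ℂ}
    (hA : MatAnalyticAt A z₀) (h : IsUnit (A z₀).det) :
    ∀ᶠ z in nhds z₀, IsUnit (A z).det := by
  simp only [isUnit_iff_ne_zero] at h ⊢
  exact hA.det.continuousAt.eventually_ne h

theorem MatAnalyticAt.eventually [Fintype β] {A : ℂ → Matrix α β ℂ} (hA : MatAnalyticAt A z₀) :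
    ∀ᶠ z in nhds z₀, MatAnalyticAt A z :=
  Filter.eventually_all.2 fun i => Filter.eventually_all.2 fun j =>
    (hA i j).eventually_analyticAt

theorem iteratedDeriv_dotProduct {f g : ℂ → α → ℂ} (hf : VecAnalyticAt f z₀)
    (hg : VecAnalyticAt g z₀) (t : ℕ) :
    iteratedDeriv t (fun z => f z ⬝ᵥ g z) z₀ =
      ∑ i ∈ Finset.range (t + 1), (t.choose i : ℂ) * (vDeriv i f z₀ ⬝ᵥ vDeriv (t - i) g z₀) := by
  simp only [_root_.dotProduct, vDeriv, Finset.mul_sum]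
  rw [iteratedDeriv_fun_sum fun i _ => (hf i).contDiffAt.mul (hg i).contDiffAt,
    Finset.sum_comm]
  refine Finset.sum_congr rfl fun i _ => ?_
  rw [iteratedDeriv_fun_mul (hf i).contDiffAt (hg i).contDiffAt]
  simp only [mul_assoc]

theorem iteratedDeriv_const_dotProduct {f : ℂ → α → ℂ} (hf : VecAnalyticAt f z₀)
    (v : α → ℂ) (t : ℕ) :
    iteratedDeriv t (fun z => v ⬝ᵥ f z) z₀ = v ⬝ᵥ vDeriv t f z₀ := by
  simp only [_root_.dotProduct, vDeriv]
  rw [iteratedDeriv_fun_sum fun i _ => contDiffAt_const.mul (hf i).contDiffAt]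
  simp only [iteratedDeriv_const_mul_field]

theorem iteratedDeriv_dotProduct_const {f : ℂ → α → ℂ} (hf : VecAnalyticAt f z₀)
    (v : α → ℂ) (t : ℕ) :
    iteratedDeriv t (fun z => f z ⬝ᵥ v) z₀ = vDeriv t f z₀ ⬝ᵥ v := by
  simpa only [dotProduct_comm] using iteratedDeriv_const_dotProduct hf v t

theorem vDeriv_const_mulVec {f : ℂ → α → ℂ} (hf : VecAnalyticAt f z₀)
    (A : Matrix γ α ℂ) (t : ℕ) :
    vDeriv t (fun z => A *ᵥ f z) z₀ = A *ᵥ vDeriv t f z₀ :=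
  funext fun i => iteratedDeriv_const_dotProduct hf (A i) t

theorem vDeriv_vecMul_const {f : ℂ → α → ℂ} (hf : VecAnalyticAt f z₀)
    (A : Matrix α γ ℂ) (t : ℕ) :
    vDeriv t (fun z => f z ᵥ* A) z₀ = vDeriv t f z₀ ᵥ* A :=
  funext fun i => iteratedDeriv_dotProduct_const hf (fun j => A j i) t

theorem vDeriv_mulVec_const {A : ℂ → Matrix γ α ℂ} (hA : MatAnalyticAt A z₀)
    (v : α → ℂ) (t : ℕ) :
    vDeriv t (fun z => A z *ᵥ v) z₀ = mDeriv t A z₀ *ᵥ v :=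
  funext fun i => iteratedDeriv_dotProduct_const (hA.row i) v t

/-- The `L`-jet of `A f` depends on `f` only through its `L`-jet. -/
theorem vDeriv_mulVec_congr {A : ℂ → Matrix γ α ℂ} {f g : ℂ → α → ℂ}
    (hA : MatAnalyticAt A z₀) (hf : VecAnalyticAt f z₀) (hg : VecAnalyticAt g z₀) {L : ℕ}
    (h : ∀ j ≤ L, vDeriv j f z₀ = vDeriv j g z₀) :
    ∀ j ≤ L, vDeriv j (fun z => A z *ᵥ f z) z₀ = vDeriv j (fun z => A z *ᵥ g z) z₀ := by
  intro j hj
  funext i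
  refine (iteratedDeriv_dotProduct (hA.row i) hf j).trans
    (Eq.trans ?_ (iteratedDeriv_dotProduct (hA.row i) hg j).symm)
  exact Finset.sum_congr rfl fun b _ => by rw [h (j - b) (by omega)]

/-- If the `L`-jet of `x` lies in the range of `V`, then the `L`-jet of `a x` depends on `a`
only through `a V`. -/
theorem iteratedDeriv_dotProduct_congr_of_range [Fintype β] {a a' x : ℂ → α → ℂ}
    {V : Matrix α β ℂ}
    (ha : VecAnalyticAt a z₀) (ha' : VecAnalyticAt a' z₀) (hx : VecAnalyticAt x z₀)
    (haV : ∀ᶠ z in nhds z₀, a z ᵥ* V = a' z ᵥ* V) {L : ℕ}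
    (h : ∀ j ≤ L, ∃ y, V *ᵥ y = vDeriv j x z₀) :
    ∀ j ≤ L, iteratedDeriv j (fun z => a z ⬝ᵥ x z) z₀ =
      iteratedDeriv j (fun z => a' z ⬝ᵥ x z) z₀ := by
  intro j hj
  rw [iteratedDeriv_dotProduct ha hx, iteratedDeriv_dotProduct ha' hx]
  refine Finset.sum_congr rfl fun b _ => ?_
  obtain ⟨y, hy⟩ := h (j - b) (by omega)
  rw [← hy, dotProduct_mulVec, dotProduct_mulVec, ← vDeriv_vecMul_const ha,
    ← vDeriv_vecMul_const ha', vDeriv_congr haV]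

variable [DecidableEq α] [Fintype β] [DecidableEq β]

/-- Hermite interpolation of the states: the reduced solution lifts to the full solution up to
order `L` when the derivatives of the latter up to order `L` lie in the range of `V`. -/
theorem vDeriv_lift_reduced {K : ℂ → Matrix α α ℂ} {V : Matrix α β ℂ} {U : Matrix β α ℂ}
    {R : ℂ → α → ℂ} (hKa : MatAnalyticAt K z₀) (hR : VecAnalyticAt R z₀)
    (hK : IsUnit (K z₀).det) (hKr : IsUnit (U * K z₀ * V).det) {L : ℕ}
    (h : ∀ j ≤ L, ∃ y, V *ᵥ y = vDeriv j (fun z => (K z)⁻¹ *ᵥ R z) z₀) :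
    ∀ j ≤ L, V *ᵥ vDeriv j (fun z => (U * K z * V)⁻¹ *ᵥ (U *ᵥ R z)) z₀ =
      vDeriv j (fun z => (K z)⁻¹ *ᵥ R z) z₀ := by
  intro j hj
  have hKr' : MatAnalyticAt (fun z => U * K z * V) z₀ :=
    ((matAnalyticAt_const U).mul hKa).mul (matAnalyticAt_const V)
  have hx : VecAnalyticAt (fun z => (K z)⁻¹ *ᵥ R z) z₀ := (hKa.inv hK).mulVec hR
  have hP : MatAnalyticAt (fun z => V * ((U * K z * V)⁻¹ * (U * K z))) z₀ :=
    (matAnalyticAt_const V).mul ((hKr'.inv hKr).mul ((matAnalyticAt_const U).mul hKa))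
  rw [← vDeriv_const_mulVec ((hKr'.inv hKr).mulVec ((matAnalyticAt_const U).mulVec hR))]
  have hev : ∀ᶠ z in nhds z₀, V *ᵥ ((U * K z * V)⁻¹ *ᵥ (U *ᵥ R z)) =
      (V * ((U * K z * V)⁻¹ * (U * K z))) *ᵥ ((K z)⁻¹ *ᵥ R z) := by
    filter_upwards [hKa.eventually_isUnit_det hK] with z hz
    simp only [mulVec_mulVec, Matrix.mul_assoc, Matrix.mul_nonsing_inv _ hz, Matrix.mul_one]
  rw [vDeriv_congr hev]
  funext i
  have hPV : ∀ᶠ z in nhds z₀,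
      (V * ((U * K z * V)⁻¹ * (U * K z))) i ᵥ* V = (1 : Matrix α α ℂ) i ᵥ* V := by
    filter_upwards [hKr'.eventually_isUnit_det hKr] with z hz
    rw [← Matrix.mul_apply_eq_vecMul, ← Matrix.mul_apply_eq_vecMul, Matrix.mul_assoc,
      Matrix.mul_assoc, Matrix.nonsing_inv_mul _ hz, Matrix.mul_one, Matrix.one_mul]
  refine (iteratedDeriv_dotProduct_congr_of_range (hP.row i) (vecAnalyticAt_const _) hx hPV h
    j hj).trans ?_
  refine congrFun (congrArg (iteratedDeriv j) (funext fun z => ?_)) z₀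
  exact congrFun (Matrix.one_mulVec ((K z)⁻¹ *ᵥ R z)) i

/-- Dual version of `vDeriv_lift_reduced`. -/
theorem vDeriv_colift_reduced {K : ℂ → Matrix α α ℂ} {V : Matrix α β ℂ} {U : Matrix β α ℂ}
    {Q : ℂ → α → ℂ} (hKa : MatAnalyticAt K z₀) (hQ : VecAnalyticAt Q z₀)
    (hK : IsUnit (K z₀).det) (hKr : IsUnit (U * K z₀ * V).det) {L : ℕ}
    (h : ∀ j ≤ L, ∃ y, y ᵥ* U = vDeriv j (fun z => Q z ᵥ* (K z)⁻¹) z₀) :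
    ∀ j ≤ L, vDeriv j (fun z => (Q z ᵥ* V) ᵥ* (U * K z * V)⁻¹) z₀ ᵥ* U =
      vDeriv j (fun z => Q z ᵥ* (K z)⁻¹) z₀ := by
  have key := vDeriv_lift_reduced (K := fun z => (K z)ᵀ) (V := Uᵀ) (U := Vᵀ) (R := Q)
    (L := L) hKa.transpose hQ (by simpa using hK)
    (by simpa [← Matrix.transpose_mul, Matrix.mul_assoc] using hKr)
  simp only [← Matrix.transpose_nonsing_inv, mulVec_transpose, ← Matrix.transpose_mul,
    ← Matrix.mul_assoc] at key
  exact key h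

/-- Two-sided Hermite interpolation: the derivatives agree up to order `2 L + 1`. -/
theorem iteratedDeriv_reduced {K : ℂ → Matrix α α ℂ} {V : Matrix α β ℂ} {U : Matrix β α ℂ}
    {Q R : ℂ → α → ℂ} (hKa : MatAnalyticAt K z₀) (hQ : VecAnalyticAt Q z₀)
    (hR : VecAnalyticAt R z₀) (hK : IsUnit (K z₀).det) (hKr : IsUnit (U * K z₀ * V).det)
    {L : ℕ} (hV : ∀ j ≤ L, ∃ y, V *ᵥ y = vDeriv j (fun z => (K z)⁻¹ *ᵥ R z) z₀)
    (hU : ∀ j ≤ L, ∃ y, y ᵥ* U = vDeriv j (fun z => Q z ᵥ* (K z)⁻¹) z₀)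
    {k : ℕ} (hk : k ≤ 2 * L + 1) :
    iteratedDeriv k (fun z => Q z ⬝ᵥ ((K z)⁻¹ *ᵥ R z)) z₀ =
      iteratedDeriv k (fun z => (Q z ᵥ* V) ⬝ᵥ ((U * K z * V)⁻¹ *ᵥ (U *ᵥ R z))) z₀ := by
  have hKr' : MatAnalyticAt (fun z => U * K z * V) z₀ :=
    ((matAnalyticAt_const U).mul hKa).mul (matAnalyticAt_const V)
  have hx : VecAnalyticAt (fun z => (K z)⁻¹ *ᵥ R z) z₀ := (hKa.inv hK).mulVec hR
  have hg : VecAnalyticAt (fun z => Q z ᵥ* (K z)⁻¹) z₀ := hQ.vecMul (hKa.inv hK)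
  have hxr : VecAnalyticAt (fun z => (U * K z * V)⁻¹ *ᵥ (U *ᵥ R z)) z₀ :=
    (hKr'.inv hKr).mulVec ((matAnalyticAt_const U).mulVec hR)
  have hgr : VecAnalyticAt (fun z => (Q z ᵥ* V) ᵥ* (U * K z * V)⁻¹) z₀ :=
    (hQ.vecMul (matAnalyticAt_const V)).vecMul (hKr'.inv hKr)
  have hVx : VecAnalyticAt (fun z => V *ᵥ ((U * K z * V)⁻¹ *ᵥ (U *ᵥ R z))) z₀ :=
    (matAnalyticAt_const V).mulVec hxr
  have hgU : VecAnalyticAt (fun z => ((Q z ᵥ* V) ᵥ* (U * K z * V)⁻¹) ᵥ* U) z₀ :=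
    hgr.vecMul (matAnalyticAt_const U)
  have hE := hg.sub hgU
  have hE0 : ∀ j ≤ L, vDeriv j (fun z => Q z ᵥ* (K z)⁻¹ -
      ((Q z ᵥ* V) ᵥ* (U * K z * V)⁻¹) ᵥ* U) z₀ = 0 := fun j hj => by
    rw [vDeriv_sub hg hgU, vDeriv_vecMul_const hgr,
      vDeriv_colift_reduced hKa hQ hK hKr hU j hj, sub_self]
  have hF := (hKa.mulVec hx).sub (hKa.mulVec hVx)
  have hF0 : ∀ j ≤ L, vDeriv j (fun z => K z *ᵥ ((K z)⁻¹ *ᵥ R z) -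
      K z *ᵥ (V *ᵥ ((U * K z * V)⁻¹ *ᵥ (U *ᵥ R z)))) z₀ = 0 := fun j hj => by
    rw [vDeriv_sub (hKa.mulVec hx) (hKa.mulVec hVx), sub_eq_zero]
    refine vDeriv_mulVec_congr hKa hx hVx (fun i hi => ?_) j hj
    rw [vDeriv_const_mulVec hxr, vDeriv_lift_reduced hKa hR hK hKr hV i hi]
  rw [← sub_eq_zero, ← iteratedDeriv_fun_sub (hQ.dotProduct hx).contDiffAt
    ((hQ.vecMul (matAnalyticAt_const V)).dotProduct hxr).contDiffAt]
  have hev : (fun z => Q z ⬝ᵥ ((K z)⁻¹ *ᵥ R z) -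
        (Q z ᵥ* V) ⬝ᵥ ((U * K z * V)⁻¹ *ᵥ (U *ᵥ R z))) =ᶠ[nhds z₀]
      fun z => (Q z ᵥ* (K z)⁻¹ - ((Q z ᵥ* V) ᵥ* (U * K z * V)⁻¹) ᵥ* U) ⬝ᵥ
        (K z *ᵥ ((K z)⁻¹ *ᵥ R z) - K z *ᵥ (V *ᵥ ((U * K z * V)⁻¹ *ᵥ (U *ᵥ R z)))) := by
    filter_upwards [hKa.eventually_isUnit_det hK, hKr'.eventually_isUnit_det hKr] with z hz hz'
    have h₁ : U * (K z * (V * (U * K z * V)⁻¹)) = 1 := by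
      simpa only [Matrix.mul_assoc] using Matrix.mul_nonsing_inv _ hz'
    have h₂ : V * (U * K z * V)⁻¹ * U * (K z * V * ((U * K z * V)⁻¹ * U)) =
        V * ((U * K z * V)⁻¹ * U) := by
      calc _ = V * (U * K z * V)⁻¹ * (U * (K z * (V * (U * K z * V)⁻¹))) * U := by
            simp only [Matrix.mul_assoc]
        _ = _ := by rw [h₁, Matrix.mul_one, Matrix.mul_assoc]
    have h₃ : (K z)⁻¹ * (K z * V * ((U * K z * V)⁻¹ * U)) = V * ((U * K z * V)⁻¹ * U) := by
      rw [Matrix.mul_assoc, Matrix.nonsing_inv_mul_cancel_left _ _ hz]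
    simp only [sub_dotProduct, dotProduct_sub, sub_vecMul, vecMul_vecMul, mulVec_mulVec,
      dotProduct_mulVec, ← Matrix.mul_assoc]
    simp only [Matrix.mul_assoc] at h₂ h₃ ⊢
    simp only [Matrix.mul_nonsing_inv _ hz, h₂, h₃, Matrix.mul_one]
    ring
  rw [hev.iteratedDeriv_eq, iteratedDeriv_dotProduct hE hF]
  refine Finset.sum_eq_zero fun i hi => ?_
  rw [Finset.mem_range] at hi
  rcases le_or_gt i L with h | h
  · rw [hE0 i h, zero_dotProduct, mul_zero]
  · rw [hF0 (k - i) (by omega), dotProduct_zero, mul_zero]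

end Analytic

section Sequences

variable {ι α β : Type*} [Fintype α] [DecidableEq α] [Fintype β]

/-- Right-hand sides of the linear systems defining the right Hermite interpolation vectors,
with all but the last argument frozen at `s`. -/
noncomputable def rightFun (K : ℂ → Matrix α α ℂ) (N : ι → ℂ → Matrix α α ℂ) (J : ℕ → ι)
    (ℓ : ℕ → ℕ) (R : ℂ → α → ℂ) (s : ℕ → ℂ) : ℕ → ℂ → α → ℂ
  | 0 => R
  | t + 1 => fun _ =>
      vDeriv (ℓ t) (fun z => N (J t) z *ᵥ ((K z)⁻¹ *ᵥ rightFun K N J ℓ R s t z)) (s t)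

/-- Right-hand sides of the (transposed) linear systems defining the left Hermite interpolation
vectors, with all but the last argument frozen at `τ`. -/
noncomputable def leftFun (K : ℂ → Matrix α α ℂ) (N : ι → ℂ → Matrix α α ℂ) (J : ℕ → ι)
    (ν : ℕ → ℕ) (Q : ℂ → α → ℂ) (τ : ℕ → ℂ) : ℕ → ℂ → α → ℂ
  | 0 => Q
  | t + 1 => fun z =>
      vDeriv (ν t) (fun w => leftFun K N J ν Q τ t w ᵥ* (K w)⁻¹) (τ t) ᵥ* N (J t) z

/-- The state chain `K(s t)⁻¹ N_{J (t-1)}(s (t-1)) ⋯ N_{J 0}(s 0) K(s 0)⁻¹ R(s 0)`. -/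
noncomputable def stateChain (K : ℂ → Matrix α α ℂ) (N : ι → ℂ → Matrix α α ℂ) (J : ℕ → ι)
    (R : ℂ → α → ℂ) (s : ℕ → ℂ) : ℕ → α → ℂ
  | 0 => (K (s 0))⁻¹ *ᵥ R (s 0)
  | t + 1 => (K (s (t + 1)))⁻¹ *ᵥ (N (J t) (s t) *ᵥ stateChain K N J R s t)

variable {K : ℂ → Matrix α α ℂ} {N : ι → ℂ → Matrix α α ℂ} {J : ℕ → ι} {ℓ : ℕ → ℕ}
  {Q R : ℂ → α → ℂ} {s s' : ℕ → ℂ}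

theorem rightFun_congr {t : ℕ} (h : ∀ u < t, s u = s' u) :
    rightFun K N J ℓ R s t = rightFun K N J ℓ R s' t := by
  induction t with
  | zero => rfl
  | succ t ih => simp only [rightFun, ih fun u hu => h u (by omega), h t (by omega)]

theorem leftFun_congr {t : ℕ} (h : ∀ u < t, s u = s' u) :
    leftFun K N J ℓ Q s t = leftFun K N J ℓ Q s' t := by
  induction t with
  | zero => rfl
  | succ t ih => simp only [leftFun, ih fun u hu => h u (by omega), h t (by omega)]

theorem stateChain_congr {t : ℕ} (h : ∀ u ≤ t, s u = s' u) :
    stateChain K N J R s t = stateChain K N J R s' t := by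
  induction t with
  | zero => simp only [stateChain, h 0 le_rfl]
  | succ t ih =>
    simp only [stateChain, ih fun u hu => h u (by omega), h t (by omega), h (t + 1) le_rfl]

theorem vecAnalyticAt_rightFun (hR : VecAnalyticAt R (s 0)) (t : ℕ) :
    VecAnalyticAt (rightFun K N J ℓ R s t) (s t) := by
  cases t with
  | zero => exact hR
  | succ t => exact vecAnalyticAt_const _

theorem vecAnalyticAt_leftFun (hQ : VecAnalyticAt Q (s 0)) {t : ℕ}
    (hN : ∀ i, MatAnalyticAt (N i) (s t)) :
    VecAnalyticAt (leftFun K N J ℓ Q s t) (s t) := by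
  cases t with
  | zero => exact hQ
  | succ t => exact (vecAnalyticAt_const _).vecMul (hN _)

theorem pD_iterate (i j : ℕ) (f : (ℕ → ℂ) → ℂ) (s : ℕ → ℂ) :
    (pD i)^[j] f s = iteratedDeriv j (fun z => f (Function.update s i z)) (s i) := by
  induction j generalizing s with
  | zero => simp
  | succ j ih =>
    rw [Function.iterate_succ_apply', pD, iteratedDeriv_succ]
    simp only [ih, Function.update_idem, Function.update_self]

theorem mixedD_congr {t : ℕ} {f g : (ℕ → ℂ) → ℂ} {s : ℕ → ℂ}
    (h : ∀ s' : ℕ → ℂ, (∀ j ≥ t, s' j = s j) → f s' = g s') :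
    mixedD ℓ t f s = mixedD ℓ t g s := by
  induction t generalizing f g with
  | zero => exact h s fun _ _ => rfl
  | succ t ih =>
    refine ih fun s' hs' => ?_
    rw [pD_iterate, pD_iterate]
    refine congrFun (congrArg _ (funext fun z => h _ fun j hj => ?_)) _
    rw [Function.update_of_ne (by omega), hs' j (by omega)]

/-- Mixed derivatives of a product chain, collected in the last variable. -/
theorem mixedD_stateChain {t : ℕ} {q : ℂ → α → ℂ}
    (hK : ∀ j ≤ t, MatAnalyticAt K (s j)) (hN : ∀ j ≤ t, ∀ i, MatAnalyticAt (N i) (s j))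
    (hdet : ∀ j ≤ t, IsUnit (K (s j)).det) (hR : VecAnalyticAt R (s 0))
    (hq : VecAnalyticAt q (s t)) :
    mixedD ℓ (t + 1) (fun s' => q (s' t) ⬝ᵥ stateChain K N J R s' t) s =
      iteratedDeriv (ℓ t) (fun z => q z ⬝ᵥ ((K z)⁻¹ *ᵥ rightFun K N J ℓ R s t z)) (s t) := by
  induction t generalizing q with
  | zero =>
    simp only [mixedD, pD_iterate, stateChain, rightFun, Function.update_self]
  | succ t ih =>
    have hqK : VecAnalyticAt (fun z => q z ᵥ* (K z)⁻¹) (s (t + 1)) :=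
      hq.vecMul ((hK _ le_rfl).inv (hdet _ le_rfl))
    set v := vDeriv (ℓ (t + 1)) (fun z => q z ᵥ* (K z)⁻¹) (s (t + 1)) with hv
    have hcongr : mixedD ℓ (t + 1 + 1)
        (fun s' => q (s' (t + 1)) ⬝ᵥ stateChain K N J R s' (t + 1)) s =
        mixedD ℓ (t + 1)
          (fun s' => (v ᵥ* N (J t) (s' t)) ⬝ᵥ stateChain K N J R s' t) s := by
      rw [mixedD]
      refine mixedD_congr fun s' hs' => ?_
      rw [pD_iterate, ← dotProduct_mulVec, hv, ← hs' (t + 1) le_rfl,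
        ← iteratedDeriv_dotProduct_const (by rwa [hs' (t + 1) le_rfl])]
      refine congrFun (congrArg _ (funext fun z => ?_)) _
      rw [stateChain, Function.update_self, Function.update_of_ne (by omega), dotProduct_mulVec,
        stateChain_congr (s' := s') fun u hu => Function.update_of_ne (by omega) _ _]
    rw [hcongr, ih (fun j hj => hK j (by omega)) (fun j hj => hN j (by omega))
      (fun j hj => hdet j (by omega)) ((vecAnalyticAt_const v).vecMul (hN t (by omega) _))]
    simp only [← dotProduct_mulVec]
    rw [iteratedDeriv_const_dotProduct ((hN t (by omega) _).mulVec
      (((hK t (by omega)).inv (hdet t (by omega))).mulVec (vecAnalyticAt_rightFun hR t)))]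
    simp only [dotProduct_mulVec]
    rw [rightFun, iteratedDeriv_dotProduct_const hqK]

/-- The collected derivative may be evaluated at any position of the chain. -/
theorem iteratedDeriv_leftFun_rightFun {q : ℕ}
    (hK : ∀ j ≤ q, MatAnalyticAt K (s j)) (hN : ∀ j ≤ q, ∀ i, MatAnalyticAt (N i) (s j))
    (hdet : ∀ j ≤ q, IsUnit (K (s j)).det) (hR : VecAnalyticAt R (s 0))
    (hQ : VecAnalyticAt Q (s q)) (t i : ℕ) (hti : t + i = q) :
    iteratedDeriv (ℓ i) (fun z =>
        leftFun K N (fun u => J (q - 1 - u)) (fun u => ℓ (q - u)) Q (fun u => s (q - u)) t z ⬝ᵥ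
          ((K z)⁻¹ *ᵥ rightFun K N J ℓ R s i z)) (s i) =
      iteratedDeriv (ℓ q) (fun z => Q z ⬝ᵥ ((K z)⁻¹ *ᵥ rightFun K N J ℓ R s q z)) (s q) := by
  induction t generalizing i with
  | zero =>
    obtain rfl : i = q := by omega
    rfl
  | succ t ih =>
    have h₁ : q - t = i + 1 := by omega
    have h₂ : q - 1 - t = i := by omega
    have hi : i ≤ q := by omega
    have hL := vecAnalyticAt_leftFun (K := K) (N := N) (J := fun u => J (q - 1 - u))
      (ℓ := fun u => ℓ (q - u)) (s := fun u => s (q - u)) (t := t) hQ (hN _ (by omega))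
    simp only [h₁] at hL
    rw [← ih (i + 1) (by omega)]
    simp only [leftFun, rightFun, h₁, h₂, ← dotProduct_mulVec]
    rw [iteratedDeriv_const_dotProduct ((hN i hi _).mulVec
      (((hK i hi).inv (hdet i hi)).mulVec (vecAnalyticAt_rightFun hR i)))]
    simp only [dotProduct_mulVec]
    rw [iteratedDeriv_dotProduct_const
      (hL.vecMul ((hK _ (by omega)).inv (hdet _ (by omega))))]

theorem rightFun_reduced [DecidableEq β] {V : Matrix α β ℂ} {U : Matrix β α ℂ} {t : ℕ}
    (hK : ∀ j < t, MatAnalyticAt K (s j)) (hN : ∀ j < t, ∀ i, MatAnalyticAt (N i) (s j))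
    (hdet : ∀ j < t, IsUnit (K (s j)).det) (hdet' : ∀ j < t, IsUnit (U * K (s j) * V).det)
    (hR : VecAnalyticAt R (s 0))
    (hV : ∀ u < t, ∀ j ≤ ℓ u, ∃ y,
      V *ᵥ y = vDeriv j (fun z => (K z)⁻¹ *ᵥ rightFun K N J ℓ R s u z) (s u)) :
    rightFun (fun z => U * K z * V) (fun i z => U * N i z * V) J ℓ (fun z => U *ᵥ R z) s t =
      fun z => U *ᵥ rightFun K N J ℓ R s t z := by
  induction t with
  | zero => rfl
  | succ t ih =>
    have hKt := hK t (by omega)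
    have hRt : VecAnalyticAt (rightFun K N J ℓ R s t) (s t) := vecAnalyticAt_rightFun hR t
    have hKr : MatAnalyticAt (fun z => U * K z * V) (s t) :=
      ((matAnalyticAt_const U).mul hKt).mul (matAnalyticAt_const V)
    have hx : VecAnalyticAt (fun z => (U * K z * V)⁻¹ *ᵥ (U *ᵥ rightFun K N J ℓ R s t z)) (s t) :=
      (hKr.inv (hdet' t (by omega))).mulVec ((matAnalyticAt_const U).mulVec hRt)
    have hVx := (matAnalyticAt_const V).mulVec hx
    have hx' : VecAnalyticAt (fun z => (K z)⁻¹ *ᵥ rightFun K N J ℓ R s t z) (s t) :=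
      (hKt.inv (hdet t (by omega))).mulVec hRt
    have hNt := hN t (by omega) (J t)
    funext _
    simp only [rightFun]
    rw [ih (fun j hj => hK j (by omega)) (fun j hj => hN j (by omega))
      (fun j hj => hdet j (by omega)) (fun j hj => hdet' j (by omega))
      (fun j hj => hV j (by omega)), ← vDeriv_const_mulVec (hNt.mulVec hx')]
    refine Eq.trans ?_ (vDeriv_mulVec_congr (matAnalyticAt_const U) (hNt.mulVec hVx)
      (hNt.mulVec hx') (vDeriv_mulVec_congr hNt hVx hx' fun j hj => ?_) (ℓ t) le_rfl)
    · simp only [mulVec_mulVec, Matrix.mul_assoc]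
    · rw [vDeriv_const_mulVec hx, vDeriv_lift_reduced hKt hRt (hdet t (by omega))
        (hdet' t (by omega)) (hV t (by omega)) j hj]

theorem leftFun_reduced [DecidableEq β] {V : Matrix α β ℂ} {U : Matrix β α ℂ} {t : ℕ}
    (hK : ∀ j < t, MatAnalyticAt K (s j)) (hN : ∀ j < t, ∀ i, MatAnalyticAt (N i) (s j))
    (hdet : ∀ j < t, IsUnit (K (s j)).det) (hdet' : ∀ j < t, IsUnit (U * K (s j) * V).det)
    (hQ : VecAnalyticAt Q (s 0))
    (hU : ∀ u < t, ∀ j ≤ ℓ u, ∃ y,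
      y ᵥ* U = vDeriv j (fun z => leftFun K N J ℓ Q s u z ᵥ* (K z)⁻¹) (s u)) :
    leftFun (fun z => U * K z * V) (fun i z => U * N i z * V) J ℓ (fun z => Q z ᵥ* V) s t =
      fun z => leftFun K N J ℓ Q s t z ᵥ* V := by
  induction t with
  | zero => rfl
  | succ t ih =>
    funext z
    simp only [leftFun]
    rw [ih (fun j hj => hK j (by omega)) (fun j hj => hN j (by omega))
      (fun j hj => hdet j (by omega)) (fun j hj => hdet' j (by omega))
      (fun j hj => hU j (by omega)), Matrix.mul_assoc, ← vecMul_vecMul,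
      vDeriv_colift_reduced (hK t (by omega)) (vecAnalyticAt_leftFun hQ (hN t (by omega)))
        (hdet t (by omega)) (hdet' t (by omega)) (hU t (by omega)) (ℓ t) le_rfl,
      ← vecMul_vecMul]

/-- The right-hand sides depend linearly on the initial one. -/
theorem rightFun_mulVec {B : ℂ → Matrix α β ℂ} {t : ℕ}
    (hK : ∀ j < t, MatAnalyticAt K (s j)) (hN : ∀ j < t, ∀ i, MatAnalyticAt (N i) (s j))
    (hdet : ∀ j < t, IsUnit (K (s j)).det) (hB : MatAnalyticAt B (s 0)) (b : β → ℂ) (z : ℂ) :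
    rightFun K N J ℓ (fun z => B z *ᵥ b) s t z =
      Matrix.of (fun i e => rightFun K N J ℓ (fun z i => B z i e) s t z i) *ᵥ b := by
  induction t generalizing z with
  | zero => rfl
  | succ t ih =>
    have hKt := (hK t (by omega)).inv (hdet t (by omega))
    have hM : MatAnalyticAt (fun z => Matrix.of
        (fun i e => rightFun K N J ℓ (fun z i => B z i e) s t z i)) (s t) :=
      fun i e => vecAnalyticAt_rightFun (fun i => hB i e) t i
    have hfun : rightFun K N J ℓ (fun z => B z *ᵥ b) s t = fun z => Matrix.of
        (fun i e => rightFun K N J ℓ (fun z i => B z i e) s t z i) *ᵥ b :=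
      funext fun z => ih (fun j hj => hK j (by omega)) (fun j hj => hN j (by omega))
        (fun j hj => hdet j (by omega)) z
    simp only [rightFun]
    rw [hfun]
    simp only [mulVec_mulVec]
    rw [vDeriv_mulVec_const ((hN t (by omega) _).mul (hKt.mul hM))]
    simp only [← Matrix.mul_assoc]
    rfl

end Sequences

section Blocks

variable {m : ℕ}

/-- The block index with entries `J (t-1), …, J 0`. -/
def outIdx (J : ℕ → Fin m) : (t : ℕ) → outT m t
  | 0 => (0 : Fin 1)
  | t + 1 => (J t, outIdx J t)

/-- The column index with entries `J (t-1), …, J 0` and innermost entry `e`. -/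
def colIdx (J : ℕ → Fin m) (e : Fin m) : (t : ℕ) → colT m t
  | 0 => e
  | t + 1 => (J t, colIdx J e t)

theorem outIdx_congr {J J' : ℕ → Fin m} {t : ℕ} (h : ∀ u < t, J u = J' u) :
    outIdx J t = outIdx J' t := by
  induction t with
  | zero => rfl
  | succ t ih => exact Prod.ext (h t (by omega)) (ih fun u hu => h u (by omega))

theorem exists_outIdx_eq (hm : 0 < m) (t : ℕ) (x : outT m t) :
    ∃ J : ℕ → Fin m, outIdx J t = x := by
  induction t with
  | zero => exact ⟨fun _ => ⟨0, hm⟩, Subsingleton.elim (α := Fin 1) _ _⟩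
  | succ t ih =>
    obtain ⟨J, hJ⟩ := ih x.2
    refine ⟨Function.update J t x.1, Prod.ext (Function.update_self ..) ?_⟩
    exact (outIdx_congr fun u hu => Function.update_of_ne hu.ne _ _).trans hJ

theorem sum_mul_tangMat (J : ℕ → Fin m) (b : Fin m → ℂ) (q : ℕ) (F : colT m q → ℂ) :
    ∑ x, F x * tangMat b q x (outIdx J q) = ∑ e, F (colIdx J e q) * b e := by
  induction q with
  | zero => rfl
  | succ q ih =>
    have key (F : Fin m × colT m q → ℂ) :
        ∑ x, F x * ((1 : Matrix (Fin m) (Fin m) ℂ) ⊗ₖ tangMat b q) x (J q, outIdx J q) =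
          ∑ y, F (J q, y) * tangMat b q y (outIdx J q) := by
      simp [Fintype.sum_prod_type, Matrix.kroneckerMap_apply, Matrix.one_apply,
        Finset.sum_ite_irrel]
    exact (key F).trans (ih fun y => F (J q, y))

theorem mul_one_kronecker_apply {α γ δ : Type*} [Fintype α] (A : Matrix γ (Fin m × α) ℂ)
    (M : Matrix α δ ℂ) (i : γ) (j : Fin m) (x : δ) :
    (A * ((1 : Matrix (Fin m) (Fin m) ℂ) ⊗ₖ M)) i (j, x) = ∑ e, A i (j, e) * M e x := by
  rw [Matrix.mul_apply, Fintype.sum_prod_type]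
  simp [Matrix.kroneckerMap_apply, Matrix.one_apply, Finset.sum_ite_irrel]

theorem conjTranspose_one_kronecker_mul_Ntil_apply {n : ℕ} {δ : Type*}
    (N : Fin m → ℂ → Matrix (Fin n) (Fin n) ℂ) (M : Matrix (Fin n) δ ℂ) (j : Fin m) (x : δ)
    (z : ℂ) (l : Fin n) :
    (((1 : Matrix (Fin m) (Fin m) ℂ) ⊗ₖ M)ᴴ * Ntil N z) (j, x) l =
      ((star fun i => M i x) ᵥ* N j z) l := by
  rw [Matrix.mul_apply, Fintype.sum_prod_type]
  simp [Matrix.kroneckerMap_apply, Matrix.one_apply, Finset.sum_ite_irrel, Ntil, vecMul,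
    _root_.dotProduct, apply_ite]

variable {n p : ℕ} {C : ℂ → Matrix (Fin p) (Fin n) ℂ} {K : ℂ → Matrix (Fin n) (Fin n) ℂ}
  {B : ℂ → Matrix (Fin n) (Fin m) ℂ} {N : Fin m → ℂ → Matrix (Fin n) (Fin n) ℂ}
  {J : ℕ → Fin m} {σ : ℕ → ℂ} {ℓ : ℕ → ℕ}

theorem Zblk_col (e : Fin m) (t : ℕ) :
    (fun i => Zblk K B N σ t i (colIdx J e t)) =
      stateChain K N J (fun z i => B z i e) σ t := by
  induction t with
  | zero => rfl
  | succ t ih =>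
    funext i
    simp only [Zblk, stateChain, colIdx]
    rw [mul_one_kronecker_apply, mulVec_mulVec, ← ih]
    rfl

theorem Gblk_apply (a : Fin p) (e : Fin m) (q : ℕ) :
    Gblk C K B N σ q a (colIdx J e q) =
      C (σ q) a ⬝ᵥ stateChain K N J (fun z i => B z i e) σ q := by
  rw [← Zblk_col]
  rfl

theorem hChainB_col (b : Fin m → ℂ) {t : ℕ} (hK : ∀ j ≤ t, MatAnalyticAt K (σ j))
    (hN : ∀ j ≤ t, ∀ i, MatAnalyticAt (N i) (σ j)) (hdet : ∀ j ≤ t, IsUnit (K (σ j)).det)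
    (z : ℂ) :
    (fun i => hChainB K B N σ ℓ b t i (outIdx J (t + 1))) =
      rightFun K N J ℓ (fun z => B z *ᵥ b) σ (t + 1) z := by
  induction t generalizing z with
  | zero =>
    funext i
    refine congrArg (fun f => iteratedDeriv (ℓ 0) f (σ 0)) (funext fun z => ?_)
    refine (mul_one_kronecker_apply _ _ i (J 0) (0 : Fin 1)).trans ?_
    simp only [Matrix.mul_assoc]
    rfl
  | succ t ih =>
    have ih' := ih (fun j hj => hK j (by omega)) (fun j hj => hN j (by omega))
      (fun j hj => hdet j (by omega))
    have hfun : rightFun K N J ℓ (fun z => B z *ᵥ b) σ (t + 1) =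
        fun _ => fun i => hChainB K B N σ ℓ b t i (outIdx J (t + 1)) :=
      funext fun z => (ih' z).symm
    rw [rightFun, hfun]
    simp only [mulVec_mulVec]
    rw [vDeriv_mulVec_const ((hN _ le_rfl _).mul ((hK _ le_rfl).inv (hdet _ le_rfl)))]
    funext i
    rw [hChainB, outIdx, mul_one_kronecker_apply]
    refine Finset.sum_congr rfl fun e _ => congrArg (· * _) ?_
    refine congrArg (fun f => iteratedDeriv (ℓ (t + 1)) f (σ (t + 1))) (funext fun z => ?_)
    exact mul_one_kronecker_apply _ _ i (J (t + 1)) e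

theorem vHermB_col (b : Fin m → ℂ) {t : ℕ} (hK : ∀ j ≤ t, MatAnalyticAt K (σ j))
    (hN : ∀ j ≤ t, ∀ i, MatAnalyticAt (N i) (σ j)) (hdet : ∀ j ≤ t, IsUnit (K (σ j)).det)
    (j : ℕ) :
    (fun i => vHermB K B N σ ℓ b t j i (outIdx J t)) =
      vDeriv j (fun z => (K z)⁻¹ *ᵥ rightFun K N J ℓ (fun z => B z *ᵥ b) σ t z) (σ t) := by
  cases t with
  | zero =>
    funext i
    refine congrArg (fun f => iteratedDeriv j f (σ 0)) (funext fun z => ?_)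
    exact congrFun (mulVec_mulVec b (K z)⁻¹ (B z)).symm i
  | succ t =>
    have hfun : rightFun K N J ℓ (fun z => B z *ᵥ b) σ (t + 1) =
        fun _ => fun i => hChainB K B N σ ℓ b t i (outIdx J (t + 1)) :=
      funext fun z => (hChainB_col b (fun j hj => hK j (by omega))
        (fun j hj => hN j (by omega)) (fun j hj => hdet j (by omega)) z).symm
    rw [hfun, vDeriv_mulVec_const ((hK _ le_rfl).inv (hdet _ le_rfl))]
    rfl

theorem wHermB_col (c : Fin p → ℂ) (t j : ℕ) :
    star (fun i => wHermB C K N σ ℓ c t j i (outIdx J t)) =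
      vDeriv j (fun z => leftFun K N J ℓ (fun z => star c ᵥ* C z) σ t z ᵥ* (K z)⁻¹) (σ t) := by
  induction t generalizing j with
  | zero =>
    funext i
    simp only [wHermB, leftFun, Pi.star_apply, Matrix.of_apply, star_star, vecMul_vecMul, vDeriv]
  | succ t ih =>
    funext i
    simp only [wHermB, leftFun, Pi.star_apply, Matrix.of_apply, star_star, vDeriv]
    refine congrFun (congrArg _ (funext fun z => ?_)) _
    refine congrArg (· ⬝ᵥ fun l => (K z)⁻¹ l i) (funext fun l => ?_)
    have h := congrArg (fun w => (w ᵥ* N (J t) z) l) (ih (ℓ t))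
    exact (conjTranspose_one_kronecker_mul_Ntil_apply N _ (J t) (outIdx J t) z l).trans h

/-- Tangential mixed derivatives of the subsystem transfer function, collected in the last
variable. -/
theorem vecMul_mixedD_Gblk (b : Fin m → ℂ) (c : Fin p → ℂ) {q : ℕ}
    (hC : MatAnalyticAt C (σ q)) (hK : ∀ j ≤ q, MatAnalyticAt K (σ j))
    (hB : MatAnalyticAt B (σ 0)) (hN : ∀ j ≤ q, ∀ i, MatAnalyticAt (N i) (σ j))
    (hdet : ∀ j ≤ q, IsUnit (K (σ j)).det) :
    Matrix.vecMul (star c)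
        ((Matrix.of fun a d => mixedD ℓ (q + 1) (fun s => Gblk C K B N s q a d) σ) *
          tangMat b q) (outIdx J q) =
      iteratedDeriv (ℓ q) (fun z => (star c ᵥ* C z) ⬝ᵥ
        ((K z)⁻¹ *ᵥ rightFun K N J ℓ (fun z => B z *ᵥ b) σ q z)) (σ q) := by
  have hM : MatAnalyticAt (fun z => Matrix.of fun i e =>
      rightFun K N J ℓ (fun z i => B z i e) σ q z i) (σ q) :=
    fun i e => vecAnalyticAt_rightFun (fun i => hB i e) q i
  have hD := hC.mul (((hK q le_rfl).inv (hdet q le_rfl)).mul hM)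
  have hR : rightFun K N J ℓ (fun z => B z *ᵥ b) σ q = fun z => Matrix.of (fun i e =>
      rightFun K N J ℓ (fun z i => B z i e) σ q z i) *ᵥ b :=
    funext fun z => rightFun_mulVec (fun j hj => hK j hj.le) (fun j hj => hN j hj.le)
      (fun j hj => hdet j hj.le) hB b z
  rw [hR]
  simp only [← dotProduct_mulVec, mulVec_mulVec]
  rw [iteratedDeriv_const_dotProduct (hD.mulVec (vecAnalyticAt_const b)),
    vDeriv_mulVec_const hD]
  refine congrArg (star c ⬝ᵥ ·) (funext fun a => ?_)
  rw [Matrix.mul_apply, sum_mul_tangMat]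
  refine Finset.sum_congr rfl fun e _ => congrArg (· * b e) ?_
  simp only [Matrix.of_apply, Gblk_apply]
  exact mixedD_stateChain hK hN hdet (fun i => hB i e) (hC.row a)

/-- First-order partial derivatives of the tangential mixed derivatives. -/
theorem pD_vecMul_mixedD_Gblk (b : Fin m → ℂ) (c : Fin p → ℂ) {q i : ℕ} (hi : i ≤ q)
    (hC : MatAnalyticAt C (σ q)) (hK : ∀ j ≤ q, MatAnalyticAt K (σ j))
    (hB : MatAnalyticAt B (σ 0)) (hN : ∀ j ≤ q, ∀ i, MatAnalyticAt (N i) (σ j))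
    (hdet : ∀ j ≤ q, IsUnit (K (σ j)).det) :
    pD i (fun s => Matrix.vecMul (star c)
        ((Matrix.of fun a d => mixedD ℓ (q + 1) (fun s => Gblk C K B N s q a d) s) *
          tangMat b q) (outIdx J q)) σ =
      iteratedDeriv (ℓ i + 1) (fun z =>
        leftFun K N (fun u => J (q - 1 - u)) (fun u => ℓ (q - u)) (fun z => star c ᵥ* C z)
            (fun u => σ (q - u)) (q - i) z ⬝ᵥ
          ((K z)⁻¹ *ᵥ rightFun K N J ℓ (fun z => B z *ᵥ b) σ i z)) (σ i) := by
  rw [iteratedDeriv_succ, pD]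
  refine Filter.EventuallyEq.deriv_eq ?_
  have update {P : ℕ → ℂ → Prop} (h : ∀ j, P j (σ j)) {z : ℂ} (hz : P i z) (j : ℕ) :
      P j (Function.update σ i z j) := by
    by_cases hj : j = i
    · subst hj; simpa using hz
    · simpa [hj] using h j
  have hev {P : ℂ → Prop} (l : ℕ) (h : l = i → ∀ᶠ z in nhds (σ i), P z) :
      ∀ᶠ z in nhds (σ i), l = i → P z := by
    by_cases hl : l = i
    · exact (h hl).mono fun _ hz _ => hz
    · exact Filter.Eventually.of_forall fun _ hz => absurd hz hl
  filter_upwards [hev q fun h => (h ▸ hC).eventually, hev 0 fun h => (h ▸ hB).eventually,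
    (hK i hi).eventually, Filter.eventually_all.2 fun ι => (hN i hi ι).eventually,
    (hK i hi).eventually_isUnit_det (hdet i hi)] with z hCz hBz hKz hNz hdz
  have hC' := update (P := fun j w => j = q → MatAnalyticAt C w)
    (fun j h => h ▸ hC) (fun h => hCz h.symm) q rfl
  have hB' := update (P := fun j w => j = 0 → MatAnalyticAt B w)
    (fun j h => h ▸ hB) (fun h => hBz h.symm) 0 rfl
  have hK' := update (P := fun j w => j ≤ q → MatAnalyticAt K w) hK (fun _ => hKz)
  have hN' := update (P := fun j w => j ≤ q → ∀ ι, MatAnalyticAt (N ι) w) hN (fun _ => hNz)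
  have hdet' := update (P := fun j w => j ≤ q → IsUnit (K w).det) hdet (fun _ => hdz)
  rw [vecMul_mixedD_Gblk b c hC' hK' hB' hN' hdet',
    ← iteratedDeriv_leftFun_rightFun hK' hN' hdet' (hB'.mulVec (vecAnalyticAt_const b))
      ((vecAnalyticAt_const _).vecMul hC') (q - i) i (by omega),
    Function.update_self,
    rightFun_congr (s' := σ) fun u hu => Function.update_of_ne (by omega) _ _,
    leftFun_congr (s' := fun u => σ (q - u)) fun u hu => Function.update_of_ne (by omega) _ _]

end Blocks

theorem stmt_15 {n m p r : ℕ} (hn : 0 < n) (hm : 0 < m) (hp : 0 < p) (hr : 0 < r)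
    (C : ℂ → Matrix (Fin p) (Fin n) ℂ) (K : ℂ → Matrix (Fin n) (Fin n) ℂ)
    (B : ℂ → Matrix (Fin n) (Fin m) ℂ) (N : Fin m → ℂ → Matrix (Fin n) (Fin n) ℂ)
    (V W : Matrix (Fin n) (Fin r) ℂ)
    (k : ℕ) (hk : 0 < k) (σ : ℕ → ℂ) (ℓ : ℕ → ℕ) (b : Fin m → ℂ) (c : Fin p → ℂ)
    (hCa : ∀ j < k, ∀ a e, AnalyticAt ℂ (fun z => C z a e) (σ j))
    (hKa : ∀ j < k, ∀ a e, AnalyticAt ℂ (fun z => K z a e) (σ j))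
    (hBa : ∀ j < k, ∀ a e, AnalyticAt ℂ (fun z => B z a e) (σ j))
    (hNa : ∀ j < k, ∀ ι a e, AnalyticAt ℂ (fun z => N ι z a e) (σ j))
    (hK : ∀ j < k, IsUnit (K (σ j)).det)
    (hKr : ∀ j < k, IsUnit (Wᴴ * K (σ j) * V).det)
    (hV : ∀ t < k, ∀ j ≤ ℓ t, ∀ cix : outT m t,
      (fun i => vHermB K B N σ ℓ b t j i cix) ∈ Set.range V.mulVec)
    (hW : ∀ t < k, ∀ j ≤ ℓ (k - 1 - t), ∀ cix : outT m t,
      (fun i =>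
        wHermB C K N (fun t => σ (k - 1 - t)) (fun t => ℓ (k - 1 - t)) c t j i cix) ∈
          Set.range W.mulVec) :
    ∀ i < k, ∀ cc : outT m (k - 1),
      pD i (fun s =>
          Matrix.vecMul (star c)
            ((Matrix.of fun a dd =>
              mixedD ℓ k (fun s' => Gblk C K B N s' (k - 1) a dd) s) *
              tangMat b (k - 1)) cc) σ =
        pD i (fun s =>
          Matrix.vecMul (star c)
            ((Matrix.of fun a dd =>
              mixedD ℓ k (fun s' => Gblk (fun s => C s * V) (fun s => Wᴴ * K s * V) (fun s => Wᴴ * B s) (fun ι s => Wᴴ * N ι s * V) s' (k - 1) a dd) s) *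
              tangMat b (k - 1)) cc) σ := by
  obtain ⟨q, rfl⟩ : ∃ q, k = q + 1 := ⟨k - 1, by omega⟩
  simp only [Nat.lt_succ_iff, Nat.add_sub_cancel] at *
  intro i hi cc
  obtain ⟨J, rfl⟩ := exists_outIdx_eq hm q cc
  have hb : ∀ z, (Wᴴ * B z) *ᵥ b = Wᴴ *ᵥ (B z *ᵥ b) := fun z => (mulVec_mulVec ..).symm
  have hc : ∀ z, star c ᵥ* (C z * V) = (star c ᵥ* C z) ᵥ* V := fun z => (vecMul_vecMul ..).symm
  have hR : VecAnalyticAt (fun z => B z *ᵥ b) (σ 0) :=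
    MatAnalyticAt.mulVec (hBa 0 (by omega)) (vecAnalyticAt_const b)
  have hQ : VecAnalyticAt (fun z => star c ᵥ* C z) (σ (q - 0)) :=
    (vecAnalyticAt_const (star c)).vecMul (hCa q le_rfl)
  have hV' : ∀ t ≤ q, ∀ j ≤ ℓ t, ∃ y, V *ᵥ y =
      vDeriv j (fun z => (K z)⁻¹ *ᵥ rightFun K N J ℓ (fun z => B z *ᵥ b) σ t z) (σ t) :=
    fun t ht j hj => by
      obtain ⟨y, hy⟩ := hV t ht j hj (outIdx J t)
      exact ⟨y, hy.trans (vHermB_col b (fun u hu => hKa u (hu.trans ht))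
        (fun u hu => hNa u (hu.trans ht)) (fun u hu => hK u (hu.trans ht)) j)⟩
  have hU' : ∀ t ≤ q, ∀ j ≤ ℓ (q - t), ∃ y, y ᵥ* Wᴴ =
      vDeriv j (fun z => leftFun K N (fun u => J (q - 1 - u)) (fun u => ℓ (q - u))
        (fun z => star c ᵥ* C z) (fun u => σ (q - u)) t z ᵥ* (K z)⁻¹) (σ (q - t)) :=
    fun t ht j hj => by
      obtain ⟨y, hy⟩ := hW t ht j hj (outIdx (fun u => J (q - 1 - u)) t)
      refine ⟨star y, ?_⟩
      rw [← star_mulVec, hy]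
      exact wHermB_col c t j
  have hKred : ∀ j ≤ q, MatAnalyticAt (fun z => Wᴴ * K z * V) (σ j) := fun j hj =>
    ((matAnalyticAt_const _).mul (hKa j hj)).mul (matAnalyticAt_const _)
  have hNred : ∀ j ≤ q, ∀ ι, MatAnalyticAt (fun z => Wᴴ * N ι z * V) (σ j) := fun j hj ι =>
    ((matAnalyticAt_const _).mul (hNa j hj ι)).mul (matAnalyticAt_const _)
  have hqi : q - (q - i) = i := by omega
  have hL := vecAnalyticAt_leftFun (K := K) (N := N) (J := fun u => J (q - 1 - u))
    (ℓ := fun u => ℓ (q - u)) (s := fun u => σ (q - u)) (t := q - i) hQ (hNa _ (by omega))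
  have hUi := hU' (q - i) (by omega)
  simp only [hqi] at hL hUi
  refine (pD_vecMul_mixedD_Gblk b c hi (hCa q le_rfl) hKa (hBa 0 (by omega)) hNa hK).trans
    (Eq.trans ?_ (pD_vecMul_mixedD_Gblk (C := fun s => C s * V) (K := fun s => Wᴴ * K s * V)
      (B := fun s => Wᴴ * B s) (N := fun ι s => Wᴴ * N ι s * V) b c hi
      (MatAnalyticAt.mul (hCa q le_rfl) (matAnalyticAt_const V)) hKred
      ((matAnalyticAt_const _).mul (hBa 0 (by omega))) hNred hKr).symm)
  simp only [hb, hc]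
  rw [rightFun_reduced (fun j hj => hKa j (by omega)) (fun j hj => hNa j (by omega))
      (fun j hj => hK j (by omega)) (fun j hj => hKr j (by omega)) hR
      (fun u hu => hV' u (by omega)),
    leftFun_reduced (fun j hj => hKa _ (by omega)) (fun j hj => hNa _ (by omega))
      (fun j hj => hK _ (by omega)) (fun j hj => hKr _ (by omega)) hQ
      (fun u hu => hU' u (by omega))]
  exact iteratedDeriv_reduced (hKa i hi) hL (vecAnalyticAt_rightFun hR i) (hK i hi) (hKr i hi)
    (hV' i hi) hUi (by omega)

end StructBilin
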